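/- Let {e_k}_{k=1}^∞ be the canonical orthonormal basis of the real Hilbert space ℓ₂ and let {x_k}_{k=1}^∞ ⊂ ℓ₂ satisfy Σ_{k=1}^∞ ‖e_k − x_k‖² ≤ 1/8. Then {x_k}_{k=1}^∞ is not injective, i.e., there exists a nonzero Hilbert–Schmidt self-adjoint operator T on ℓ₂ with ⟨T x_k, x_k⟩ = 0 for all k. -/

import Mathlib

open scoped InnerProductSpace

/-- The real Hilbert space `ℓ₂`. -/
abbrev ell2 : Type := lp (fun _ : ℕ => ℝ) 2

/-- `T` is a Hilbert–Schmidt operator on `ℓ₂`: `Σ_i ‖T e_i‖² < ∞` for the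
canonical orthonormal basis `{e_i}`. -/
def IsHilbertSchmidt (T : ell2 →L[ℝ] ell2) : Prop :=
  Summable fun i : ℕ => ‖T (lp.single 2 i (1 : ℝ))‖ ^ 2

theorem stmt_18_summable_sq (u : ell2) : Summable fun i : ℕ => ‖u i‖ ^ 2 := by
  have h := (lp.memℓp u).summable (by norm_num)
  simpa using h

theorem stmt_18_inner_single (u : ell2) (k : ℕ) :
    ⟪lp.single 2 k (1 : ℝ), u⟫_ℝ = u k := by
  have h := lp.inner_single_left (𝕜 := ℝ) (G := fun _ : ℕ => ℝ) k (1 : ℝ) u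
  simpa using h

theorem stmt_18_op (d : ℕ → ell2) (hs : Summable fun k : ℕ => ‖d k‖ ^ 2)
    (hle : ∑' k : ℕ, ‖d k‖ ^ 2 ≤ 1 / 8) :
    ∃ D : ell2 →L[ℝ] ell2, ‖D‖ < 1 ∧ ∀ y k, D y k = ⟪d k, y⟫_ℝ := by
  have hb : ∀ (y : ell2) k, ‖(⟪d k, y⟫_ℝ : ℝ)‖ ^ 2 ≤ ‖d k‖ ^ 2 * ‖y‖ ^ 2 := by
    intro y k
    rw [← mul_pow]
    gcongr
    exact norm_inner_le_norm _ _
  have hsy : ∀ y : ell2, Summable fun k => ‖(⟪d k, y⟫_ℝ : ℝ)‖ ^ 2 := fun y =>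
    Summable.of_nonneg_of_le (fun _ => by positivity) (hb y) (hs.mul_right _)
  have hm : ∀ y : ell2, Memℓp (fun k : ℕ => (⟪d k, y⟫_ℝ : ℝ)) 2 := fun y =>
    memℓp_gen (by simpa using hsy y)
  let L : ell2 →ₗ[ℝ] ell2 :=
    { toFun := fun y => ⟨fun k => ⟪d k, y⟫_ℝ, hm y⟩
      map_add' := fun y z => by
        ext k
        exact inner_add_right _ _ _
      map_smul' := fun c y => by
        ext k
        exact inner_smul_right _ _ _ }
  have hL : ∀ y k, L y k = ⟪d k, y⟫_ℝ := fun _ _ => rfl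
  have hn : ∀ y, ‖L y‖ ≤ 1 / 2 * ‖y‖ := by
    intro y
    have h1 : ‖L y‖ ^ 2 = ∑' k, ‖L y k‖ ^ 2 := by
      have h := lp.norm_rpow_eq_tsum (p := 2) (by norm_num) (L y)
      simpa using h
    have h2 : ‖L y‖ ^ 2 ≤ 1 / 8 * ‖y‖ ^ 2 := by
      rw [h1]
      calc ∑' k, ‖L y k‖ ^ 2 ≤ ∑' k, ‖d k‖ ^ 2 * ‖y‖ ^ 2 :=
            (hsy y).tsum_le_tsum (hb y) (hs.mul_right _)
        _ = (∑' k, ‖d k‖ ^ 2) * ‖y‖ ^ 2 := tsum_mul_right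
        _ ≤ _ := by gcongr
    apply le_of_sq_le_sq _ (by positivity)
    nlinarith [sq_nonneg ‖y‖]
  refine ⟨L.mkContinuous (1 / 2) hn, ?_, fun y k => hL y k⟩
  exact lt_of_le_of_lt (L.mkContinuous_norm_le (by norm_num) hn) (by norm_num)

/-- If `{e_k}` is the canonical orthonormal basis of the real
`ℓ₂` and `{x_k} ⊂ ℓ₂` satisfies `Σ_k ‖e_k − x_k‖² ≤ 1/8`, then `{x_k}` is not
injective: there is a nonzero Hilbert–Schmidt self-adjoint operator `T` with
`⟨T x_k, x_k⟩ = 0` for all `k`. -/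
theorem stmt_18 (x : ℕ → ell2)
    (hsum : Summable fun k : ℕ => ‖lp.single 2 k (1 : ℝ) - x k‖ ^ 2)
    (hle : ∑' k : ℕ, ‖lp.single 2 k (1 : ℝ) - x k‖ ^ 2 ≤ 1 / 8) :
    ∃ T : ell2 →L[ℝ] ell2, IsHilbertSchmidt T ∧ IsSelfAdjoint T ∧ T ≠ 0 ∧
      ∀ k, ⟪T (x k), x k⟫_ℝ = 0 := by
  obtain ⟨D, hD, hDk⟩ := stmt_18_op _ hsum hle
  obtain ⟨U, hU⟩ := isUnit_one_sub_of_norm_lt_one hD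
  have key : ∀ w : ell2, ∃ u : ell2, ∀ k, ⟪u, x k⟫_ℝ = w k := by
    intro w
    refine ⟨(↑U⁻¹ : ell2 →L[ℝ] ell2) w, fun k => ?_⟩
    set u := (↑U⁻¹ : ell2 →L[ℝ] ell2) w with hu
    have h1 : (1 - D) u = w := by
      rw [hu, ← hU, ← ContinuousLinearMap.mul_apply, Units.mul_inv]
      rfl
    have h2 : u k - D u k = w k := by
      rw [← h1]; rfl
    rw [hDk, inner_sub_left, stmt_18_inner_single] at h2
    rw [real_inner_comm]
    linarith
  obtain ⟨u, hu⟩ := key (lp.single 2 0 (1 : ℝ))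
  obtain ⟨v, hv⟩ := key (lp.single 2 1 (1 : ℝ))
  let T : ell2 →L[ℝ] ell2 :=
    (innerSL ℝ u).smulRight v + (innerSL ℝ v).smulRight u
  have hT : ∀ y, T y = (⟪u, y⟫_ℝ : ℝ) • v + (⟪v, y⟫_ℝ : ℝ) • u := fun y => rfl
  refine ⟨T, ?_, ?_, ?_, ?_⟩
  · unfold IsHilbertSchmidt
    refine Summable.of_nonneg_of_le (fun _ => by positivity) (fun i => ?_)
      (((stmt_18_summable_sq u).mul_right (2 * ‖v‖ ^ 2)).add
        ((stmt_18_summable_sq v).mul_right (2 * ‖u‖ ^ 2)))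
    rw [hT, real_inner_comm, stmt_18_inner_single, real_inner_comm, stmt_18_inner_single]
    have h := norm_add_le (u i • v) (v i • u)
    rw [norm_smul, norm_smul] at h
    have h0 := norm_nonneg (u i • v + v i • u)
    nlinarith [sq_nonneg (‖u i‖ * ‖v‖ - ‖v i‖ * ‖u‖), pow_le_pow_left₀ h0 h 2]
  · rw [ContinuousLinearMap.isSelfAdjoint_iff_isSymmetric]
    intro y z
    change ⟪T y, z⟫_ℝ = ⟪y, T z⟫_ℝ
    rw [hT, hT, inner_add_left, inner_add_right, real_inner_smul_left, real_inner_smul_left,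
      real_inner_smul_right, real_inner_smul_right, real_inner_comm v y, real_inner_comm u y]
    ring
  · intro h0
    have h1 : ⟪T (x 0), x 1⟫_ℝ = 0 := by rw [h0]; simp
    rw [hT, inner_add_left, real_inner_smul_left, real_inner_smul_left, hu, hu, hv, hv] at h1
    simp [lp.single_apply] at h1
  · intro k
    rw [hT, inner_add_left, real_inner_smul_left, real_inner_smul_left, hu, hv]
    rcases eq_or_ne k 0 with rfl | hk
    · simp [lp.single_apply]
    · simp [lp.single_apply, hk]
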